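/- For every integer n ≥ 2 there exists a constant C > 0 (depending only on n) such that for every squarefree integer d ≥ 2 and every integer H ≥ 1, |#H_n(d,H) − 2^{n+1} H^{n+1} φ(d)² / d^{n+2}| ≤ C · H^n · 2^{ω(d)} / d^{n−1}. -/

import Mathlib

open Polynomial Filter

/-- Height of an integer polynomial: the maximum of the absolute values of its coefficients. -/
def polyHeight (f : Polynomial ℤ) : ℕ :=
  (Finset.range (f.natDegree + 1)).sup fun i => (f.coeff i).natAbs

/-- `H_n(d,H)`: polynomials of degree exactly `n` and height at most `H` with `d ∣ aᵢ` for
`i = 0, …, n-1`, `gcd(a₀/d, d) = 1` and `gcd(aₙ, d) = 1`. -/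
def Hset (n d H : ℕ) : Set (Polynomial ℤ) :=
  {f | f.natDegree = n ∧ polyHeight f ≤ H ∧ (∀ i < n, (d : ℤ) ∣ f.coeff i) ∧
    Int.gcd (f.coeff 0 / d) d = 1 ∧ Int.gcd f.leadingCoeff d = 1}

open Finset in
/-- The number of integers `1 ≤ a ≤ N` coprime to `d`. -/
def coprimeCount (d N : ℕ) : ℕ := #{a ∈ Icc 1 N | a.Coprime d}

open Finset in
theorem coprimeCount_le (d N : ℕ) : coprimeCount d N ≤ N := by
  simpa [coprimeCount] using card_filter_le (Icc 1 N) (fun a => a.Coprime d)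

open Finset in
theorem coprimeCount_one (N : ℕ) : coprimeCount 1 N = N := by
  simp [coprimeCount]

open Finset in
/-- Sieving out one further prime. -/
theorem coprimeCount_prime_mul {p a : ℕ} (hp : p.Prime) (hpa : p.Coprime a) (N : ℕ) :
    coprimeCount (p * a) N + coprimeCount a (N / p) = coprimeCount a N := by
  have hsplit := card_filter_add_card_filter_not
    (s := {b ∈ Icc 1 N | b.Coprime a}) (fun b => b.Coprime p)
  have hcoprime : ({b ∈ Icc 1 N | b.Coprime a} : Finset ℕ).filter (fun b => b.Coprime p) =
      {b ∈ Icc 1 N | b.Coprime (p * a)} := by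
    ext b
    simp only [mem_filter, Nat.coprime_mul_iff_right]
    tauto
  have hmultiples : ({b ∈ Icc 1 N | b.Coprime a} : Finset ℕ).filter (fun b => ¬ b.Coprime p) =
      ({b ∈ Icc 1 (N / p) | b.Coprime a} : Finset ℕ).image (p * ·) := by
    ext b
    simp only [mem_filter, mem_image, mem_Icc]
    constructor
    · rintro ⟨⟨⟨hb, hbN⟩, hba⟩, hbp⟩
      obtain ⟨c, rfl⟩ : p ∣ b := by
        by_contra h
        exact hbp ((hp.coprime_iff_not_dvd.2 h).symm)
      refine ⟨c, ⟨⟨Nat.pos_of_mul_pos_left hb, ?_⟩, (Nat.coprime_mul_iff_left.1 hba).2⟩, rfl⟩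
      rwa [Nat.le_div_iff_mul_le hp.pos, mul_comm]
    · rintro ⟨c, ⟨⟨hc, hcN⟩, hca⟩, rfl⟩
      refine ⟨⟨⟨Nat.mul_pos hp.pos hc, ?_⟩, Nat.coprime_mul_iff_left.2 ⟨hpa, hca⟩⟩, ?_⟩
      · rwa [Nat.le_div_iff_mul_le hp.pos, mul_comm] at hcN
      · exact fun h => (hp.coprime_iff_not_dvd.1 h.symm) (dvd_mul_right p c)
  rw [hcoprime, hmultiples,
    card_image_of_injective _ (mul_right_injective₀ hp.ne_zero)] at hsplit
  exact hsplit

/-- The Legendre sieve. -/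
theorem abs_coprimeCount_floor_sub_le {d : ℕ} (hd : Squarefree d) {x : ℝ} (hx : 0 ≤ x) :
    |(coprimeCount d ⌊x⌋₊ : ℝ) - x * ((d.totient : ℝ) / d)| ≤ 2 ^ d.primeFactors.card := by
  induction d using induction_on_primes generalizing x with
  | zero => exact absurd hd not_squarefree_zero
  | one =>
    have h₁ := Nat.floor_le hx
    have h₂ := Nat.lt_floor_add_one x
    simp only [coprimeCount_one, Nat.totient_one, Nat.primeFactors_one, Finset.card_empty,
      Nat.cast_one, div_one, mul_one, pow_zero]
    rw [abs_le]
    constructor <;> linarith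
  | prime_mul p a hp ih =>
    have hpa : p.Coprime a := Nat.coprime_of_squarefree_mul hd
    have ha : Squarefree a := hd.of_mul_right
    have hp₀ : (p : ℝ) ≠ 0 := Nat.cast_ne_zero.2 hp.ne_zero
    have ha₀ : (a : ℝ) ≠ 0 := Nat.cast_ne_zero.2 ha.ne_zero
    have hcard : (p * a).primeFactors.card = a.primeFactors.card + 1 := by
      rw [hpa.primeFactors_mul, Finset.card_union_of_disjoint hpa.disjoint_primeFactors,
        hp.primeFactors, Finset.card_singleton, add_comm]
    have hsieve := coprimeCount_prime_mul hp hpa ⌊x⌋₊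
    rw [← Nat.floor_div_natCast] at hsieve
    have hsieve' : (coprimeCount (p * a) ⌊x⌋₊ : ℝ) =
        coprimeCount a ⌊x⌋₊ - coprimeCount a ⌊x / p⌋₊ := by
      rw [← hsieve]; push_cast; ring
    have htotient : x * (((p * a).totient : ℝ) / (p * a : ℕ)) =
        x * ((a.totient : ℝ) / a) - x / p * ((a.totient : ℝ) / a) := by
      rw [Nat.totient_mul hpa, Nat.totient_prime hp]
      push_cast [Nat.cast_sub hp.one_le]
      field_simp
    have h₁ := ih ha hx
    have h₂ := ih ha (x := x / p) (by positivity)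
    rw [hcard, hsieve', htotient, pow_succ]
    rw [abs_le] at *
    constructor <;> linarith [h₁.1, h₁.2, h₂.1, h₂.2]

open Finset in
/-- Integers of absolute value at most `N` coprime to `d`. -/
noncomputable def coprimeBox (d N : ℕ) : Finset ℤ := {a ∈ Icc (-N : ℤ) N | Int.gcd a d = 1}

open Finset in
theorem card_coprimeBox {d : ℕ} (hd : 2 ≤ d) (N : ℕ) :
    #(coprimeBox d N) = 2 * coprimeCount d N := by
  set s : Finset ℕ := {a ∈ Icc 1 N | a.Coprime d} with hs
  have hunion : coprimeBox d N =
      s.image (fun a : ℕ => (a : ℤ)) ∪ s.image (fun a : ℕ => -(a : ℤ)) := by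
    ext a
    simp only [coprimeBox, hs, mem_filter, mem_Icc, mem_union, mem_image]
    simp only [Int.gcd, Int.natAbs_natCast, Nat.Coprime]
    constructor
    · rintro ⟨⟨h₁, h₂⟩, h⟩
      have ha : a.natAbs ≠ 0 := by
        intro ha
        rw [ha, Nat.gcd_zero_left] at h
        omega
      rcases Int.natAbs_eq a with h' | h'
      · exact .inl ⟨a.natAbs, ⟨by omega, h⟩, h'.symm⟩
      · exact .inr ⟨a.natAbs, ⟨by omega, h⟩, h'.symm⟩
    · rintro (⟨b, ⟨hb, h⟩, rfl⟩ | ⟨b, ⟨hb, h⟩, rfl⟩)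
      · exact ⟨by omega, by simpa using h⟩
      · exact ⟨by omega, by simpa using h⟩
  have hdisjoint : Disjoint (s.image (fun a : ℕ => (a : ℤ))) (s.image (fun a : ℕ => -(a : ℤ))) := by
    rw [disjoint_left]
    simp only [hs, mem_image, mem_filter, mem_Icc]
    rintro _ ⟨b, ⟨hb, -⟩, rfl⟩ ⟨c, ⟨hc, -⟩, h⟩
    omega
  have hneg : Function.Injective (fun a : ℕ => -(a : ℤ)) :=
    neg_injective.comp Nat.cast_injective
  rw [hunion, card_union_of_disjoint hdisjoint, card_image_of_injective _ Nat.cast_injective,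
    card_image_of_injective _ hneg, coprimeCount, two_mul]

/-- The admissible values of the `i`-th coefficient of a polynomial in `Hset n d H`. -/
noncomputable def coeffBox (n d H i : ℕ) : Finset ℤ :=
  if i = n then coprimeBox d H
  else if i = 0 then (coprimeBox d (H / d)).image (fun b => (d : ℤ) * b)
  else (Finset.Icc (-(H / d : ℕ) : ℤ) (H / d : ℕ)).image (fun b => (d : ℤ) * b)

theorem natAbs_mul_le_iff {d : ℕ} (hd : 0 < d) (H : ℕ) (b : ℤ) :
    ((d : ℤ) * b).natAbs ≤ H ↔ -((H / d : ℕ) : ℤ) ≤ b ∧ b ≤ (H / d : ℕ) := by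
  rw [Int.natAbs_mul, Int.natAbs_natCast, mul_comm, ← Nat.le_div_iff_mul_le hd]
  omega

theorem mem_coeffBox_iff {n d : ℕ} (hn : n ≠ 0) (hd : 0 < d) (H i : ℕ) (a : ℤ) :
    a ∈ coeffBox n d H i ↔ a.natAbs ≤ H ∧ (i ≠ n → (d : ℤ) ∣ a) ∧
      (i = 0 → Int.gcd (a / d) d = 1) ∧ (i = n → Int.gcd a d = 1) := by
  have hd' : (d : ℤ) ≠ 0 := by exact_mod_cast hd.ne'
  unfold coeffBox
  split_ifs with hin hi
  · subst hin
    simp only [coprimeBox, Finset.mem_filter, Finset.mem_Icc]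
    have : (-(H : ℤ) ≤ a ∧ a ≤ H) ↔ a.natAbs ≤ H := by omega
    simp [this, hn]
  · simp only [coprimeBox, Finset.mem_image, Finset.mem_filter, Finset.mem_Icc]
    constructor
    · rintro ⟨b, ⟨hb, h⟩, rfl⟩
      refine ⟨(natAbs_mul_le_iff hd H b).2 hb, fun _ => dvd_mul_right _ _, fun _ => ?_,
        fun h => absurd h hin⟩
      rwa [Int.mul_ediv_cancel_left _ hd']
    · rintro ⟨h₁, h₂, h₃, -⟩
      obtain ⟨b, rfl⟩ := h₂ hin
      have h₄ := h₃ hi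
      rw [Int.mul_ediv_cancel_left _ hd'] at h₄
      exact ⟨b, ⟨(natAbs_mul_le_iff hd H b).1 h₁, h₄⟩, rfl⟩
  · simp only [Finset.mem_image, Finset.mem_Icc]
    constructor
    · rintro ⟨b, hb, rfl⟩
      exact ⟨(natAbs_mul_le_iff hd H b).2 hb, fun _ => dvd_mul_right _ _, fun h => absurd h hi,
        fun h => absurd h hin⟩
    · rintro ⟨h₁, h₂, -, -⟩
      obtain ⟨b, rfl⟩ := h₂ hin
      exact ⟨b, (natAbs_mul_le_iff hd H b).1 h₁, rfl⟩

theorem polyHeight_le_iff (f : ℤ[X]) (H : ℕ) :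
    polyHeight f ≤ H ↔ ∀ i ≤ f.natDegree, (f.coeff i).natAbs ≤ H := by
  simp [polyHeight, Finset.sup_le_iff]

theorem mem_Hset_iff {n d : ℕ} (hn : n ≠ 0) (hd : 2 ≤ d) (H : ℕ) (f : ℤ[X]) :
    f ∈ Hset n d H ↔ f.natDegree ≤ n ∧ ∀ i ≤ n, f.coeff i ∈ coeffBox n d H i := by
  simp only [mem_coeffBox_iff hn (by omega : 0 < d)]
  constructor
  · rintro ⟨rfl, hH, hdvd, h₀, hlead⟩
    rw [polyHeight_le_iff] at hH
    refine ⟨le_rfl, fun i hi => ⟨hH i hi, fun h => hdvd i (by omega), ?_, ?_⟩⟩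
    · rintro rfl
      exact h₀
    · rintro rfl
      exact hlead
  · rintro ⟨hdeg, h⟩
    have hlead := (h n le_rfl).2.2.2 rfl
    have hcoeff : f.coeff n ≠ 0 := by
      intro h'
      rw [h', Int.gcd_zero_left, Int.natAbs_natCast] at hlead
      omega
    obtain rfl : f.natDegree = n := hdeg.antisymm (le_natDegree_of_ne_zero hcoeff)
    exact ⟨rfl, (polyHeight_le_iff f H).2 fun i hi => (h i hi).1,
      fun i hi => (h i hi.le).2.1 hi.ne, (h 0 (Nat.zero_le _)).2.2.1 rfl, hlead⟩

theorem card_Hset_eq_prod {n d : ℕ} (hn : n ≠ 0) (hd : 2 ≤ d) (H : ℕ) :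
    Nat.card (Hset n d H) = ∏ i : Fin (n + 1), (coeffBox n d H i).card := by
  rw [← Fintype.card_piFinset, Nat.card_coe_set_eq, ← Set.ncard_coe_finset]
  refine Set.BijOn.ncard_eq (f := fun (f : ℤ[X]) (i : Fin (n + 1)) => f.coeff i) ⟨?_, ?_, ?_⟩
  · intro f hf
    rw [mem_Hset_iff hn hd] at hf
    simp only [Finset.mem_coe, Fintype.mem_piFinset]
    exact fun i => hf.2 i (Nat.lt_succ_iff.1 i.2)
  · intro f hf g hg hfg
    rw [mem_Hset_iff hn hd] at hf hg
    ext i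
    by_cases hi : i ≤ n
    · exact congrFun hfg ⟨i, Nat.lt_succ_iff.2 hi⟩
    · rw [coeff_eq_zero_of_natDegree_lt (by omega), coeff_eq_zero_of_natDegree_lt (by omega)]
  · intro v hv
    simp only [Finset.mem_coe, Fintype.mem_piFinset] at hv
    have hcoeff (i : Fin (n + 1)) : (ofFn (n + 1) v).coeff i = v i :=
      ofFn_coeff_eq_val_of_lt v i.2
    refine ⟨ofFn (n + 1) v, ?_, funext hcoeff⟩
    rw [mem_Hset_iff hn hd]
    refine ⟨Nat.lt_succ_iff.1 (ofFn_natDegree_lt (by omega) v), fun i hi => ?_⟩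
    have := hv ⟨i, Nat.lt_succ_iff.2 hi⟩
    rwa [← hcoeff] at this

theorem card_Hset_eq {n d : ℕ} (hn : 1 ≤ n) (hd : 2 ≤ d) (H : ℕ) :
    Nat.card (Hset n d H) =
      2 * coprimeCount d H * (2 * coprimeCount d (H / d)) * (2 * (H / d) + 1) ^ (n - 1) := by
  obtain ⟨m, rfl⟩ : ∃ m, n = m + 1 := ⟨n - 1, by omega⟩
  have hinj : Function.Injective (fun b : ℤ => (d : ℤ) * b) :=
    mul_right_injective₀ (by exact_mod_cast (by omega : d ≠ 0))
  have hlast : (coeffBox (m + 1) d H (m + 1)).card = 2 * coprimeCount d H := by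
    rw [coeffBox, if_pos rfl, card_coprimeBox hd]
  have hzero : (coeffBox (m + 1) d H 0).card = 2 * coprimeCount d (H / d) := by
    rw [coeffBox, if_neg (by omega), if_pos rfl, Finset.card_image_of_injective _ hinj,
      card_coprimeBox hd]
  have hmid (i : Fin m) : (coeffBox (m + 1) d H (i + 1)).card = 2 * (H / d) + 1 := by
    rw [coeffBox, if_neg (by omega), if_neg (by omega), Finset.card_image_of_injective _ hinj,
      Int.card_Icc]
    omega
  rw [card_Hset_eq_prod m.succ_ne_zero hd, Fin.prod_univ_castSucc, Fin.prod_univ_succ]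
  simp only [Fin.val_last, Fin.val_castSucc, Fin.val_zero, Fin.val_succ, hlast, hzero, hmid,
    Finset.prod_const, Finset.card_univ, Fintype.card_fin, Nat.add_sub_cancel]
  ring

theorem mul_abs_pow_sub_pow_le {x a b : ℝ} (hx : 0 ≤ x) (ha : |a| ≤ 3 * x) (hb : |b| ≤ 3 * x)
    (hab : |a - b| ≤ 1) (k : ℕ) : x * |a ^ k - b ^ k| ≤ k * 3 ^ k * x ^ k := by
  induction k with
  | zero => simp
  | succ k ih =>
    have hbk : |b ^ k| ≤ (3 * x) ^ k := by
      rw [abs_pow]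
      gcongr
    calc x * |a ^ (k + 1) - b ^ (k + 1)|
        = x * |a * (a ^ k - b ^ k) + (a - b) * b ^ k| := by ring_nf
      _ ≤ x * (|a| * |a ^ k - b ^ k| + |a - b| * |b ^ k|) := by
        rw [← abs_mul, ← abs_mul]
        gcongr
        exact abs_add_le _ _
      _ = |a| * (x * |a ^ k - b ^ k|) + x * (|a - b| * |b ^ k|) := by ring
      _ ≤ 3 * x * (k * 3 ^ k * x ^ k) + x * (1 * (3 * x) ^ k) := by gcongr
      _ ≤ (k + 1 : ℕ) * 3 ^ (k + 1) * x ^ (k + 1) := by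
        have : 0 ≤ 3 ^ k * x ^ (k + 1) := by positivity
        rw [mul_pow]
        push_cast
        linear_combination 2 * this

/-- Perturbation of the product of the three main terms. -/
theorem abs_mul_mul_pow_sub_le {A B M A' B' h x W : ℝ} (k : ℕ) (hx : 0 ≤ x) (hxh : x ≤ h)
    (hW : 1 ≤ W) (hA : |A - A'| ≤ 2 * W) (hB : |B - B'| ≤ 2 * W) (hM : |M - 2 * x| ≤ 1)
    (hB₂ : |B| ≤ 2 * x) (hA' : |A'| ≤ 2 * h) (hB' : |B'| ≤ 2 * x) (hM₃ : |M| ≤ 3 * x) :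
    |A * B * M ^ k - A' * B' * (2 * x) ^ k| ≤ 4 * (k + 2) * 3 ^ k * h * W * x ^ k := by
  have hh : 0 ≤ h := hx.trans hxh
  have hMk : |M ^ k| ≤ (3 * x) ^ k := by
    rw [abs_pow]
    gcongr
  have hpow := mul_abs_pow_sub_pow_le hx hM₃ (by rw [abs_of_nonneg (by positivity)]; linarith) hM k
  calc |A * B * M ^ k - A' * B' * (2 * x) ^ k|
      = |(A - A') * B * M ^ k + A' * (B - B') * M ^ k + A' * B' * (M ^ k - (2 * x) ^ k)| := by
        ring_nf
    _ ≤ |A - A'| * |B| * |M ^ k| + |A'| * |B - B'| * |M ^ k| +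
          |A'| * |B'| * |M ^ k - (2 * x) ^ k| := by
        simp only [← abs_mul]
        exact abs_add_three _ _ _
    _ ≤ 2 * W * (2 * h) * (3 * x) ^ k + 2 * h * (2 * W) * (3 * x) ^ k +
          2 * h * (2 * x) * |M ^ k - (2 * x) ^ k| := by
        have : |B| ≤ 2 * h := by linarith
        gcongr
    _ = 8 * 3 ^ k * h * W * x ^ k + 4 * h * (x * |M ^ k - (2 * x) ^ k|) := by
        rw [mul_pow]
        ring
    _ ≤ 8 * 3 ^ k * h * W * x ^ k + 4 * h * (W * (k * 3 ^ k * x ^ k)) := by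
        gcongr _ + 4 * h * ?_
        exact hpow.trans (le_mul_of_one_le_left (by positivity) hW)
    _ = 4 * (k + 2) * 3 ^ k * h * W * x ^ k := by ring

/-- For every `n ≥ 2` and squarefree `d ≥ 2`:
`#H_n(d,H) = 2ⁿ⁺¹Hⁿ⁺¹φ(d)²/dⁿ⁺² + O(Hⁿ 2^{ω(d)}/dⁿ⁻¹)`, uniformly in `d` and `H`. -/
theorem card_Hset (n : ℕ) (hn : 2 ≤ n) :
    ∃ C : ℝ, 0 < C ∧ ∀ d : ℕ, 2 ≤ d → Squarefree d → ∀ H : ℕ, 1 ≤ H →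
      |(Nat.card (Hset n d H) : ℝ) -
          2^(n + 1) * (H : ℝ)^(n + 1) * (Nat.totient d : ℝ)^2 / (d : ℝ)^(n + 2)| ≤
        C * (H : ℝ)^n * 2^(d.primeFactors.card) / (d : ℝ)^(n - 1) := by
  obtain ⟨k, rfl⟩ : ∃ k, n = k + 1 := ⟨n - 1, by omega⟩
  refine ⟨4 * (k + 2) * 3 ^ k, by positivity, fun d hd hsq H hH => ?_⟩
  have hd₀ : (0 : ℝ) < d := by exact_mod_cast (by omega : 0 < d)
  have hd₁ : (1 : ℝ) ≤ d := by exact_mod_cast (by omega : 1 ≤ d)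
  set x : ℝ := (H : ℝ) / d with hx
  set r : ℝ := (d.totient : ℝ) / d with hr
  set W : ℝ := 2 ^ d.primeFactors.card with hW
  have hx₀ : 0 ≤ x := by positivity
  have hxH : x ≤ H := div_le_self (Nat.cast_nonneg _) hd₁
  have hr₀ : 0 ≤ r := by positivity
  have hr₁ : r ≤ 1 := div_le_one_of_le₀ (by exact_mod_cast d.totient_le) hd₀.le
  have hW₁ : 1 ≤ W := one_le_pow₀ one_le_two
  have hmain : 2 ^ (k + 1 + 1) * (H : ℝ) ^ (k + 1 + 1) * (d.totient : ℝ) ^ 2 /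
      (d : ℝ) ^ (k + 1 + 2) = 2 * (H * r) * (2 * (x * r)) * (2 * x) ^ k := by
    rw [hx, hr, mul_pow, div_pow]
    field_simp
    ring
  have herror : 4 * (k + 2) * 3 ^ k * (H : ℝ) ^ (k + 1) * W / (d : ℝ) ^ (k + 1 - 1) =
      4 * (k + 2) * 3 ^ k * H * W * x ^ k := by
    rw [hx, Nat.add_sub_cancel, div_pow]
    field_simp
    ring
  have hfloor : ⌊x⌋₊ = H / d := Nat.floor_div_eq_div H d
  have hA' : |2 * (H * r)| ≤ 2 * H := by
    rw [abs_of_nonneg (by positivity)]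
    gcongr
    exact mul_le_of_le_one_right (by positivity) hr₁
  have hB' : |2 * (x * r)| ≤ 2 * x := by
    rw [abs_of_nonneg (by positivity)]
    gcongr
    exact mul_le_of_le_one_right hx₀ hr₁
  rw [hmain, herror, card_Hset_eq (Nat.le_add_left 1 k) hd, ← hfloor, Nat.add_sub_cancel]
  have hfloor_le := Nat.floor_le hx₀
  have hcount_le : (coprimeCount d ⌊x⌋₊ : ℝ) ≤ ⌊x⌋₊ := by exact_mod_cast coprimeCount_le d _
  rcases lt_or_ge x 1 with hx₁ | hx₁
  · have hcount : coprimeCount d ⌊x⌋₊ = 0 := by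
      have := coprimeCount_le d ⌊x⌋₊
      rw [Nat.floor_eq_zero.2 hx₁] at this ⊢
      omega
    rw [hcount]
    simp only [mul_zero, zero_mul, Nat.cast_zero, zero_sub, abs_neg]
    calc |2 * (H * r) * (2 * (x * r)) * (2 * x) ^ k|
        = |2 * (H * r)| * |2 * (x * r)| * (2 * x) ^ k := by
          rw [abs_mul, abs_mul, abs_of_nonneg (by positivity : 0 ≤ (2 * x) ^ k)]
      _ ≤ 2 * H * 2 * (3 * x) ^ k := by
          have : |2 * (x * r)| ≤ 2 := by linarith
          gcongr
          norm_num
      _ = 4 * 1 * 3 ^ k * H * 1 * x ^ k := by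
          rw [mul_pow]
          ring
      _ ≤ 4 * (k + 2) * 3 ^ k * H * W * x ^ k := by
          have : (1 : ℝ) ≤ k + 2 := by
            have : (0 : ℝ) ≤ k := Nat.cast_nonneg k
            linarith
          gcongr
  · have hA := abs_coprimeCount_floor_sub_le hsq (Nat.cast_nonneg (α := ℝ) H)
    have hB := abs_coprimeCount_floor_sub_le hsq hx₀
    rw [Nat.floor_natCast] at hA
    have hlt := Nat.lt_floor_add_one x
    push_cast
    refine abs_mul_mul_pow_sub_le k hx₀ hxH hW₁ ?_ ?_ ?_ ?_ hA' hB' ?_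
    · rw [← mul_sub, abs_mul, abs_two]
      gcongr
    · rw [← mul_sub, abs_mul, abs_two]
      gcongr
    · rw [abs_le]
      constructor <;> linarith
    · rw [abs_of_nonneg (by positivity)]
      linarith
    · rw [abs_of_nonneg (by positivity)]
      linarith
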